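/- arXiv:2308.07256 — 3 statements merged into one kernel-verified Lean document; each statement's English description precedes it below -/
import Mathlib

section
/- Let n, d, r be positive integers, let π = (π_1 | … | π_d) be an ordered set partition in OP(n,d,r), and let σ be a permutation of {1,…,d}. Define σ(π) to be the ordered set partition with blocks σ(π)_i = π_{σ^{-1}(i)}. Then the map sending T ∈ J_r(π) to the tableau T' obtained from T by permuting its columns according to σ is a bijection from J_r(π) to J_r(σ(π)), and for every T ∈ J_r(π) one has sgn(T) = sgn(σ)^r · sgn(T'). -/
open scoped Classical

namespace Jellyfish

/-- A tableau with `ν` rows and `d` columns, whose cells are either empty or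
contain an element of `Fin n`. -/
abbrev Tab (ν n d : ℕ) := Fin ν → Fin d → Option (Fin n)

/-- `π` is an ordered set partition of `[n]` into `d` blocks, each of size at least `r`:
blocks are pairwise disjoint with union `[n]` and cardinality at least `r`. -/
def IsOSP (n d r : ℕ) (π : Fin d → Finset (Fin n)) : Prop :=
  (∀ j, r ≤ (π j).card) ∧
  (∀ j k, j ≠ k → Disjoint (π j) (π k)) ∧
  (Finset.univ.biUnion π = Finset.univ)

/-- The nonempty entries of column `j` of `T`, read from top to bottom. -/
def colList {ν n d : ℕ} (T : Tab ν n d) (j : Fin d) : List (Fin n) :=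
  (List.finRange ν).filterMap (fun i => T i j)

/-- `T` is an `r`-jellyfish tableau for `π`: it has `n - (d-1)r` rows and `d` columns,
every cell in the first `r` rows is nonempty, every lower row has exactly one nonempty
cell, and the nonempty entries of column `j`, top to bottom, are exactly the elements
of `π j` in increasing order. -/
def IsJelly (n d r : ℕ) (π : Fin d → Finset (Fin n)) (T : Tab (n - (d-1)*r) n d) : Prop :=
  (∀ i : Fin (n - (d-1)*r), (i : ℕ) < r → ∀ j, (T i j).isSome) ∧
  (∀ i : Fin (n - (d-1)*r), r ≤ (i : ℕ) → ∃! j, (T i j).isSome) ∧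
  (∀ j, colList T j = (π j).sort (· ≤ ·))

/-- The row reading word of `T` (rows top to bottom, each row left to right), with
each entry tagged by its column index. -/
def cells {ν n d : ℕ} (T : Tab ν n d) : List (Fin d × Fin n) :=
  (List.finRange ν).flatMap (fun i =>
    (List.finRange d).filterMap (fun j => (T i j).map (fun v => (j, v))))

/-- The number of inversions of a (column-tagged) word: pairs of positions `p < q`
whose values are inverted. -/
def invList {n d : ℕ} : List (Fin d × Fin n) → ℕ
  | [] => 0
  | a :: l => l.countP (fun b => decide (b.2 < a.2)) + invList l

/-- The number of inversions of a (column-tagged) word that do not involve two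
entries lying in the same column. -/
def invList' {n d : ℕ} : List (Fin d × Fin n) → ℕ
  | [] => 0
  | a :: l => l.countP (fun b => decide (b.2 < a.2 ∧ b.1 ≠ a.1)) + invList' l

/-- The sign `(-1)^(inv T)` of a tableau, where `inv T` counts all inversions of the
row reading word. -/
def tabSign {ν n d : ℕ} (T : Tab ν n d) : ℤ := (-1) ^ invList (cells T)

/-- The sign `(-1)^(inv T)` of a (column-permuted) tableau, where inversions within a
single column are not counted. -/
def tabSign' {ν n d : ℕ} (T : Tab ν n d) : ℤ := (-1) ^ invList' (cells T)

/-- The minor `M_I^J` of the `ν × n` matrix of indeterminates `x_{ij}`: the determinant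
of the submatrix with rows `I` and columns `J`, each taken in increasing order
(and `0` if `|I| ≠ |J|`). -/
noncomputable def minor (ν n : ℕ) (I : Finset (Fin ν)) (J : Finset (Fin n)) :
    MvPolynomial (Fin ν × Fin n) ℂ :=
  if h : I.card = J.card then
    Matrix.det (Matrix.of fun a b : Fin I.card =>
      MvPolynomial.X (I.orderEmbOfFin rfl a, J.orderEmbOfFin h.symm b))
  else 0

/-- The set `R_j(T)` of rows of `T` containing an entry of block `j`. -/
def rowsUsed {ν n d : ℕ} (T : Tab ν n d) (j : Fin d) : Finset (Fin ν) :=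
  Finset.univ.filter (fun i => (T i j).isSome)

/-- The product of minors `J(T) = ∏_j M_{R_j(T)}^{π_j}`. -/
noncomputable def JProd {ν n d : ℕ} (π : Fin d → Finset (Fin n)) (T : Tab ν n d) :
    MvPolynomial (Fin ν × Fin n) ℂ :=
  ∏ j : Fin d, minor ν n (rowsUsed T j) (π j)

/-- The `r`-jellyfish invariant `[π]_r = Σ_{T ∈ J_r(π)} sgn(T)·J(T)`. -/
noncomputable def jellyInv (n d r : ℕ) (π : Fin d → Finset (Fin n)) :
    MvPolynomial (Fin (n - (d-1)*r) × Fin n) ℂ :=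
  ∑ T : Tab (n - (d-1)*r) n d,
    if IsJelly n d r π T then (tabSign T : ℂ) • JProd π T else 0


/-- Permute the columns of `T` according to `σ`: column `j` of the result is
column `σ⁻¹ j` of `T`. -/
def colPerm {ν n d : ℕ} (σ : Equiv.Perm (Fin d)) (T : Tab ν n d) : Tab ν n d :=
  fun i j => T i (σ⁻¹ j)

/-- The top `k` rows of a tableau with `ν` rows. -/
def topRows (ν k : ℕ) : Finset (Fin ν) := Finset.univ.filter (fun i => (i : ℕ) < k)

/-- The top-justified minor `p_J`, using rows `1, …, |J|` and the columns in `J`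
(in increasing order). -/
noncomputable def topMinor (ν n : ℕ) (J : Finset (Fin n)) :
    MvPolynomial (Fin ν × Fin n) ℂ :=
  minor ν n (topRows ν J.card) J

/-- The spanning set of the flamingo Specht module `S^{(d^r, 1^{n-rd})}`: all products
`∏_i p_{J_i}` over tuples `(J_1, …, J_d)` of pairwise disjoint subsets of `[n]` with
union `[n]`, `|J_1| = n-(d-1)r` and `|J_i| = r` for `i ≥ 2`. -/
def flamingoSet (n d r : ℕ) : Set (MvPolynomial (Fin (n - (d-1)*r) × Fin n) ℂ) :=
  { f | ∃ Js : Fin d → Finset (Fin n),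
      (∀ i j, i ≠ j → Disjoint (Js i) (Js j)) ∧
      (Finset.univ.biUnion Js = Finset.univ) ∧
      (∀ i : Fin d, (i : ℕ) = 0 → (Js i).card = n - (d-1)*r) ∧
      (∀ i : Fin d, (i : ℕ) ≠ 0 → (Js i).card = r) ∧
      f = ∏ i : Fin d, topMinor (n - (d-1)*r) n (Js i) }

/-- `P` is an (unordered) set partition of `[n]`: a collection of pairwise disjoint
nonempty blocks whose union is `[n]`. -/
def IsUPartition (n : ℕ) (P : Finset (Finset (Fin n))) : Prop :=
  (∀ B ∈ P, B.Nonempty) ∧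
  (∀ B1 ∈ P, ∀ B2 ∈ P, B1 ≠ B2 → Disjoint B1 B2) ∧
  (∀ x : Fin n, ∃ B ∈ P, x ∈ B)

/-- `P` is noncrossing: there do not exist `a < b < c < e` with `a, c` in one block
and `b, e` in a different block. -/
def IsNoncrossing (n : ℕ) (P : Finset (Finset (Fin n))) : Prop :=
  ∀ a b c e : Fin n, a < b → b < c → c < e →
    ∀ B1 ∈ P, ∀ B2 ∈ P, a ∈ B1 → c ∈ B1 → b ∈ B2 → e ∈ B2 → B1 = B2

/-- `P` is a noncrossing set partition of `[n]` into `d` blocks, each of size at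
least `r` (the set `NC(n,d,r)`). -/
def IsNCPartition (n d r : ℕ) (P : Finset (Finset (Fin n))) : Prop :=
  IsUPartition n P ∧ IsNoncrossing n P ∧ P.card = d ∧ ∀ B ∈ P, r ≤ B.card

/-- The set of smallest elements of the blocks of an ordered set partition. -/
def blockMinima (n d : ℕ) (π : Fin d → Finset (Fin n)) : Finset (Fin n) :=
  Finset.univ.filter (fun x => ∃ j, x ∈ π j ∧ ∀ y ∈ π j, x ≤ y)

/-- The set of smallest elements (block minima) of an unordered set partition. -/
def blockMinimaU (n : ℕ) (P : Finset (Finset (Fin n))) : Finset (Fin n) :=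
  Finset.univ.filter (fun x => ∃ B ∈ P, x ∈ B ∧ ∀ y ∈ B, x ≤ y)

/-- The set of largest elements (block maxima) of an unordered set partition. -/
def blockMaximaU (n : ℕ) (P : Finset (Finset (Fin n))) : Finset (Fin n) :=
  Finset.univ.filter (fun x => ∃ B ∈ P, x ∈ B ∧ ∀ y ∈ B, y ≤ x)

theorem neg_one_pow_countP_ofFn {α : Type*} {d : ℕ} (p : α → Bool) (w : Fin d → α) :
    (-1 : ℤ) ^ (List.ofFn w).countP p = ∏ j, if p (w j) then -1 else 1 := by
  induction d with
  | zero => simp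
  | succ d ih =>
    rw [List.ofFn_succ, List.countP_cons, pow_add, ih, Fin.prod_univ_succ, mul_comm]
    split_ifs <;> simp

section ListSign

variable {α ι : Type*} [LinearOrder α]

/-- The number of inversions of a word. -/
def wordInv : List α → ℕ
  | [] => 0
  | a :: l => l.countP (fun b => decide (b < a)) + wordInv l

/-- The sign of a word. -/
def wordSign (l : List α) : ℤ := (-1) ^ wordInv l

/-- The number of pairs consisting of an entry of `l` and a smaller entry of `m`. -/
def crossInv (l m : List α) : ℕ :=
  (l.map fun a => m.countP fun b => decide (b < a)).sum

theorem wordInv_append (l m : List α) :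
    wordInv (l ++ m) = wordInv l + crossInv l m + wordInv m := by
  induction l with
  | nil => simp [wordInv, crossInv]
  | cons a l ih =>
    simp only [List.cons_append, wordInv, ih, List.countP_append, crossInv, List.map_cons,
      List.sum_cons]
    ring

theorem crossInv_congr {l l' m m' : List α} (hl : l.Perm l') (hm : m.Perm m') :
    crossInv l m = crossInv l' m' := by
  simp only [crossInv, hm.countP_eq]
  exact (hl.map _).sum_eq

theorem wordSign_append (l m : List α) :
    wordSign (l ++ m) = wordSign l * (-1) ^ crossInv l m * wordSign m := by
  simp only [wordSign, wordInv_append, pow_add]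

/-- Rearranging each row of a stack of rows changes the sign of the reading word by the
product of the changes of sign of the rows. -/
theorem wordSign_flatMap (L : List ι) (f g : ι → List α) (c : ι → ℤ)
    (hperm : ∀ i, (f i).Perm (g i)) (hsign : ∀ i, wordSign (f i) = c i * wordSign (g i)) :
    wordSign (L.flatMap f) = (L.map c).prod * wordSign (L.flatMap g) := by
  induction L with
  | nil => simp
  | cons i L ih =>
    rw [List.flatMap_cons, List.flatMap_cons, wordSign_append, wordSign_append, ih, hsign,
      crossInv_congr (hperm i) (List.Perm.flatMap_left L fun j _ => hperm j), List.map_cons,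
      List.prod_cons]
    ring

theorem wordSign_ofFn {d : ℕ} (w : Fin d → α) :
    wordSign (List.ofFn w) = ∏ i, ∏ j ∈ Finset.Ioi i, if w j < w i then -1 else 1 := by
  induction d with
  | zero => simp [wordSign, wordInv]
  | succ d ih =>
    have h := ih fun i => w i.succ
    rw [wordSign] at h ⊢
    rw [List.ofFn_succ, wordInv, pow_add, h, neg_one_pow_countP_ofFn, Fin.prod_univ_succ,
      Fin.Ioi_zero_eq_map, Finset.prod_map]
    simp only [Fin.Ioi_succ, Finset.prod_map, Fin.coe_succEmb, decide_eq_true_eq]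
    congr!

theorem wordSign_ofFn_comp {d : ℕ} (σ : Equiv.Perm (Fin d)) {w : Fin d → α}
    (hw : Function.Injective w) :
    wordSign (List.ofFn fun j => w (σ j)) = Equiv.Perm.sign σ * wordSign (List.ofFn w) := by
  have key := σ.prod_Ioi_comp_eq_sign_mul_prod (R := ℤ)
    (f := fun i j => if w j < w i then -1 else if w i < w j then 1 else 0) fun i j => by
      rcases lt_trichotomy (w i) (w j) with h | h | h <;> simp [h, h.not_gt]
  have sign_eq : ∀ v : Fin d → α, Function.Injective v → wordSign (List.ofFn v) =
      ∏ i, ∏ j ∈ Finset.Ioi i, if v j < v i then -1 else if v i < v j then 1 else 0 := by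
    intro v hv
    rw [wordSign_ofFn]
    refine Finset.prod_congr rfl fun i _ => Finset.prod_congr rfl fun j hj => ?_
    rcases lt_or_gt_of_ne (hv.ne (Finset.mem_Ioi.1 hj).ne) with h | h <;> simp [h, h.not_gt]
  rw [sign_eq (fun j => w (σ j)) (hw.comp σ.injective), sign_eq w hw]
  simpa using key

end ListSign

theorem invList_eq_wordInv {n d : ℕ} (l : List (Fin d × Fin n)) :
    invList l = wordInv (l.map Prod.snd) := by
  induction l with
  | nil => rfl
  | cons a l ih => simp [invList, wordInv, ih, List.countP_map, Function.comp_def]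

/-- The nonempty entries of a row, read from left to right. -/
def rowWord {n d : ℕ} (t : Fin d → Option (Fin n)) : List (Fin n) :=
  (List.finRange d).filterMap t

theorem tabSign_eq_wordSign {ν n d : ℕ} (T : Tab ν n d) :
    tabSign T = wordSign ((List.finRange ν).flatMap fun i => rowWord (T i)) := by
  rw [tabSign, wordSign, invList_eq_wordInv, cells, List.map_flatMap]
  simp [rowWord, List.map_filterMap, Function.comp_def]

theorem rowWord_comp_perm {n d : ℕ} (σ : Equiv.Perm (Fin d)) (t : Fin d → Option (Fin n)) :
    (rowWord fun j => t (σ j)).Perm (rowWord t) := by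
  have h := (Equiv.Perm.map_finRange_perm σ).filterMap t
  rwa [List.filterMap_map] at h

theorem rowWord_some {n d : ℕ} (w : Fin d → Fin n) :
    rowWord (fun j => some (w j)) = List.ofFn w := by
  simp [rowWord, List.ofFn_eq_map]

theorem rowWord_eq_singleton {n d : ℕ} {t : Fin d → Option (Fin n)}
    (h : ∃! j, (t j).isSome) : ∃ v, rowWord t = [v] := by
  obtain ⟨j, hj, huniq⟩ := h
  obtain ⟨v, hv⟩ := Option.isSome_iff_exists.1 hj
  obtain ⟨a, b, hab⟩ := List.append_of_mem (List.mem_finRange j)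
  have hnd := List.nodup_finRange d
  rw [hab, List.nodup_middle, List.nodup_cons, List.mem_append, not_or] at hnd
  have none_of_ne : ∀ k, k ≠ j → t k = none := fun k hk => by
    by_contra hne
    exact hk (huniq k (Option.isSome_iff_ne_none.2 hne))
  have ha : a.filterMap t = [] := List.filterMap_eq_nil_iff.2 fun k hk =>
    none_of_ne k fun hkj => hnd.1.1 (hkj ▸ hk)
  have hb : b.filterMap t = [] := List.filterMap_eq_nil_iff.2 fun k hk =>
    none_of_ne k fun hkj => hnd.1.2 (hkj ▸ hk)
  exact ⟨v, by rw [rowWord, hab, List.filterMap_append, List.filterMap_cons, hv, ha, hb]; rfl⟩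

theorem IsJelly.mem {n d r : ℕ} {π : Fin d → Finset (Fin n)} {T : Tab (n - (d-1)*r) n d}
    (hT : IsJelly n d r π T) {i : Fin (n - (d-1)*r)} {j : Fin d} {v : Fin n}
    (h : T i j = some v) : v ∈ π j := by
  rw [← Finset.mem_sort (· ≤ ·), ← hT.2.2 j]
  exact List.mem_filterMap.2 ⟨i, List.mem_finRange i, h⟩

theorem IsJelly.colPerm {n d r : ℕ} {π : Fin d → Finset (Fin n)} {T : Tab (n - (d-1)*r) n d}
    (hT : IsJelly n d r π T) (σ : Equiv.Perm (Fin d)) :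
    IsJelly n d r (fun i => π (σ⁻¹ i)) (colPerm σ T) := by
  refine ⟨fun i hi j => hT.1 i hi _, fun i hi => ?_, fun j => hT.2.2 (σ⁻¹ j)⟩
  obtain ⟨j, hj, huniq⟩ := hT.2.1 i hi
  refine ⟨σ j, by simpa [Jellyfish.colPerm] using hj, fun k hk => ?_⟩
  exact Equiv.Perm.inv_eq_iff_eq.1 (huniq _ hk)

theorem IsOSP.le_rows {n d r : ℕ} {π : Fin d → Finset (Fin n)} (hπ : IsOSP n d r π)
    (hd : 0 < d) : r ≤ n - (d-1)*r := by
  have hcard : ∑ j, (π j).card = n := by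
    rw [← Finset.card_biUnion fun j _ k _ hjk => hπ.2.1 j k hjk, hπ.2.2]
    simp
  have hle : d * r ≤ n := by
    rw [← hcard]
    simpa using Finset.card_nsmul_le_sum Finset.univ (fun j => (π j).card) r fun j _ => hπ.1 j
  obtain ⟨e, rfl⟩ := Nat.exists_eq_succ_of_ne_zero hd.ne'
  rw [Nat.succ_mul] at hle
  simp only [Nat.succ_eq_add_one, Nat.add_sub_cancel]
  omega

theorem tabSign_colPerm {n d r : ℕ} (hd : 0 < d) {π : Fin d → Finset (Fin n)}
    (hπ : IsOSP n d r π) {T : Tab (n - (d-1)*r) n d} (hT : IsJelly n d r π T)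
    (σ : Equiv.Perm (Fin d)) :
    tabSign (colPerm σ T) = (Equiv.Perm.sign σ : ℤ) ^ r * tabSign T := by
  rw [tabSign_eq_wordSign, tabSign_eq_wordSign,
    wordSign_flatMap _ (fun i => rowWord (colPerm σ T i)) (fun i => rowWord (T i))
      (fun i => if (i : ℕ) < r then (Equiv.Perm.sign σ : ℤ) else 1)
      (fun i => rowWord_comp_perm σ⁻¹ (T i))]
  · congr 1
    rw [← List.ofFn_eq_map, List.prod_ofFn, Finset.prod_ite, Finset.prod_const_one, mul_one,
      Finset.prod_const, Fin.card_filter_val_lt, min_eq_right (hπ.le_rows hd)]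
  · intro i
    split_ifs with hi
    · choose w hw using fun j => Option.isSome_iff_exists.1 (hT.1 i hi j)
      have hinj : Function.Injective w := fun j k hjk => by
        by_contra hne
        exact Finset.disjoint_left.1 (hπ.2.1 j k hne) (hT.mem (hw j)) (hjk ▸ hT.mem (hw k))
      have hrow : rowWord (T i) = List.ofFn w := by rw [← rowWord_some, ← funext hw]
      have hrow' : rowWord (colPerm σ T i) = List.ofFn fun j => w (σ⁻¹ j) := by
        rw [← rowWord_some]
        exact congrArg rowWord (funext fun j => hw _)
      rw [hrow, hrow', wordSign_ofFn_comp _ hinj, Equiv.Perm.sign_inv]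
    · obtain ⟨v, hv⟩ := rowWord_eq_singleton (hT.2.1 i (not_lt.1 hi))
      have hperm : (rowWord (colPerm σ T i)).Perm (rowWord (T i)) :=
        rowWord_comp_perm σ⁻¹ (T i)
      rw [hv, List.perm_singleton] at hperm
      rw [hperm, hv, one_mul]

/-- permuting the columns of jellyfish tableaux according to `σ` gives a
bijection `J_r(π) → J_r(σ(π))`, and `sgn(T) = sgn(σ)^r · sgn(T')`. -/
theorem statement0 (n d r : ℕ) (hn : 0 < n) (hd : 0 < d) (hr : 0 < r)
    (π : Fin d → Finset (Fin n)) (hπ : IsOSP n d r π) (σ : Equiv.Perm (Fin d)) :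
    Set.BijOn (colPerm σ)
      {T : Tab (n - (d-1)*r) n d | IsJelly n d r π T}
      {T : Tab (n - (d-1)*r) n d | IsJelly n d r (fun i => π (σ⁻¹ i)) T} ∧
    ∀ T : Tab (n - (d-1)*r) n d, IsJelly n d r π T →
      tabSign T = ((Equiv.Perm.sign σ : ℤ)) ^ r * tabSign (colPerm σ T) := by
  refine ⟨⟨fun T hT => hT.colPerm σ, fun S _ T _ h => ?_, fun T hT => ?_⟩, fun T hT => ?_⟩
  · funext i j
    simpa [colPerm] using congrFun (congrFun h i) (σ j)
  · exact ⟨colPerm σ⁻¹ T, by simpa using IsJelly.colPerm hT σ⁻¹, by funext i j; simp [colPerm]⟩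
  · rw [tabSign_colPerm hd hπ hT, ← mul_assoc, ← mul_pow, Int.units_coe_mul_self, one_pow,
      one_mul]

end Jellyfish
end

section
/- Let n, d, r be positive integers, let π ∈ OP(n,d,r), let U ∈ J_r(π), and let T be a tableau obtained from U by permuting entries within columns (keeping the set of filled cells in each column the same). Then sgn(U) = sgn(T), where for a column-permuted jellyfish tableau T one defines sgn(T) = (−1)^{inv(T)} with inv(T) the number of inversions of the row reading word of T that do NOT involve two entries lying in the same column. -/
open scoped Classical

namespace Jellyfish

/-- The sum of `f a b` over all pairs of entries `a` before `b` of a list. -/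
def pairSum {α : Type*} (f : α → α → ZMod 2) : List α → ZMod 2
  | [] => 0
  | a :: l => (l.map (f a)).sum + pairSum f l

theorem pairSum_perm {α : Type*} {f : α → α → ZMod 2} (hf : ∀ a b, f a b = f b a)
    {l₁ l₂ : List α} (h : l₁.Perm l₂) : pairSum f l₁ = pairSum f l₂ := by
  induction h with
  | nil => rfl
  | cons a h ih => simp only [pairSum, ih, (h.map (f a)).sum_eq]
  | swap a b l =>
    simp only [pairSum, List.map_cons, List.sum_cons, hf a b]
    ring
  | trans _ _ ih₁ ih₂ => exact ih₁.trans ih₂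

theorem pairSum_add {α : Type*} (f g : α → α → ZMod 2) (l : List α) :
    pairSum (fun a b => f a b + g a b) l = pairSum f l + pairSum g l := by
  induction l with
  | nil => simp [pairSum]
  | cons a l ih =>
    simp only [pairSum, ih, List.sum_map_add]
    ring

theorem pairSum_map {α β : Type*} (φ : α → β) (f : β → β → ZMod 2) (l : List α) :
    pairSum f (l.map φ) = pairSum (fun a b => f (φ a) (φ b)) l := by
  induction l with
  | nil => rfl
  | cons a l ih => simp [pairSum, ih, Function.comp_def]

theorem pairSum_congr {α : Type*} {f g : α → α → ZMod 2} {l : List α}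
    (h : ∀ a ∈ l, ∀ b ∈ l, f a b = g a b) : pairSum f l = pairSum g l := by
  induction l with
  | nil => rfl
  | cons a l ih =>
    simp only [pairSum]
    rw [ih fun x hx y hy => h x (List.mem_cons_of_mem _ hx) y (List.mem_cons_of_mem _ hy),
      List.map_congr_left fun b hb => h a List.mem_cons_self b (List.mem_cons_of_mem _ hb)]

theorem natCast_countP {α : Type*} (p : α → Prop) [DecidablePred p] (l : List α) :
    ((l.countP (fun b => decide (p b)) : ℕ) : ZMod 2) =
      (l.map fun b => if p b then 1 else 0).sum := by
  induction l with
  | nil => simp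
  | cons a l ih =>
    by_cases h : p a <;> simp [h, ih, add_comm]

theorem natCast_invList' {n d : ℕ} (l : List (Fin d × Fin n)) :
    (invList' l : ZMod 2) =
      pairSum (fun a b => if b.2 < a.2 ∧ b.1 ≠ a.1 then 1 else 0) l := by
  induction l with
  | nil => simp [invList', pairSum]
  | cons a l ih =>
    rw [invList', pairSum, Nat.cast_add, ih,
      natCast_countP (fun b : Fin d × Fin n => b.2 < a.2 ∧ b.1 ≠ a.1)]

/-- The parity of the cross-column inversions splits into a part that is symmetric in the
two cells and a part that only depends on the columns. -/
theorem natCast_invList'_eq_add {n d : ℕ} {l : List (Fin d × Fin n)}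
    (hl : ∀ a ∈ l, ∀ b ∈ l, a.1 ≠ b.1 → a.2 ≠ b.2) :
    (invList' l : ZMod 2) =
      pairSum (fun a b : Fin d × Fin n =>
        if (a.1 < b.1 ∧ b.2 < a.2) ∨ (b.1 < a.1 ∧ a.2 < b.2) then 1 else 0) l +
      pairSum (fun i j : Fin d => if j < i then 1 else 0) (l.map Prod.fst) := by
  rw [natCast_invList', pairSum_map, ← pairSum_add]
  refine pairSum_congr fun a ha b hb => ?_
  have two : (1 : ZMod 2) + 1 = 0 := rfl
  rcases lt_trichotomy a.1 b.1 with h | h | h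
  · simp [h, h.ne', h.not_gt]
  · simp [h]
  · rcases lt_or_gt_of_ne (hl a ha b hb h.ne') with h' | h'
    · simp [h, h', h.not_gt, h'.not_gt, two]
    · simp [h, h', h.not_gt, h'.not_gt, h.ne]

theorem natCast_invList'_congr {n d : ℕ} {l₁ l₂ : List (Fin d × Fin n)}
    (hl : ∀ a ∈ l₁, ∀ b ∈ l₁, a.1 ≠ b.1 → a.2 ≠ b.2) (hp : l₁.Perm l₂)
    (hfst : l₁.map Prod.fst = l₂.map Prod.fst) :
    (invList' l₁ : ZMod 2) = invList' l₂ := by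
  rw [natCast_invList'_eq_add hl, natCast_invList'_eq_add fun a ha b hb =>
    hl a (hp.mem_iff.2 ha) b (hp.mem_iff.2 hb), hfst]
  congr 1
  refine pairSum_perm (fun a b => ?_) hp
  simp only [or_comm]

theorem invList_eq_invList' {n d : ℕ} {l : List (Fin d × Fin n)}
    (h : l.Pairwise fun a b => a.1 = b.1 → a.2 ≤ b.2) : invList l = invList' l := by
  induction h with
  | nil => rfl
  | @cons a l hal _ ih =>
    rw [invList, invList', ih]
    congr 1
    refine List.countP_congr fun b hb => ?_
    simp only [decide_eq_true_eq]
    exact ⟨fun hlt => ⟨hlt, fun he => (hal b hb he.symm).not_gt hlt⟩, And.left⟩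

theorem mem_cells {ν n d : ℕ} {T : Tab ν n d} {a : Fin d × Fin n} :
    a ∈ cells T ↔ ∃ i, T i a.1 = some a.2 := by
  obtain ⟨j, v⟩ := a
  simp [cells]

theorem mem_colList {ν n d : ℕ} {T : Tab ν n d} {j : Fin d} {v : Fin n} :
    v ∈ colList T j ↔ ∃ i, T i j = some v := by
  simp [colList]

theorem map_fst_cells_congr {ν n d : ℕ} {T U : Tab ν n d}
    (h : ∀ i j, (T i j).isSome = (U i j).isSome) :
    (cells T).map Prod.fst = (cells U).map Prod.fst := by
  have hcell : ∀ i j, (T i j).map (fun _ => j) = (U i j).map fun _ => j := fun i j => by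
    have := h i j
    cases hT : T i j <;> cases hU : U i j <;> simp_all
  simp only [cells, List.map_flatMap, List.map_filterMap, Option.map_map, Function.comp_def, hcell]

theorem cells_perm_flatMap_colList {ν n d : ℕ} (T : Tab ν n d) :
    (cells T).Perm ((List.finRange d).flatMap fun j => (colList T j).map fun v => (j, v)) := by
  have h := Multiset.bind_bind (List.finRange ν : Multiset (Fin ν))
    (List.finRange d : Multiset (Fin d))
    (f := fun i j => (((T i j).map fun v => (j, v)).toList : Multiset (Fin d × Fin n)))
  simp only [Multiset.coe_bind, Multiset.coe_eq_coe] at h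
  simpa only [cells, colList, List.filterMap_eq_flatMap_toList, List.map_flatMap,
    Option.toList_map] using h

theorem cells_perm {ν n d : ℕ} {T U : Tab ν n d}
    (h : ∀ j, (colList T j).Perm (colList U j)) : (cells T).Perm (cells U) :=
  ((cells_perm_flatMap_colList T).trans
    (List.Perm.flatMap_left _ fun j _ => (h j).map _)).trans (cells_perm_flatMap_colList U).symm

theorem pairwise_cells {ν n d : ℕ} {T : Tab ν n d}
    (h : ∀ j, (colList T j).Pairwise (· ≤ ·)) :
    (cells T).Pairwise fun a b => a.1 = b.1 → a.2 ≤ b.2 := by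
  rw [cells, List.pairwise_flatMap]
  constructor
  · intro i _
    rw [List.pairwise_filterMap]
    refine (List.nodup_finRange d).imp fun {j k} hjk a ha b hb he => ?_
    simp only [Option.map_eq_some_iff] at ha hb
    obtain ⟨v, -, rfl⟩ := ha
    obtain ⟨w, -, rfl⟩ := hb
    exact absurd he hjk
  · rw [List.pairwise_iff_getElem]
    rintro p q hp hq hpq ⟨j, v⟩ ha ⟨k, w⟩ hb (rfl : j = k)
    have hj := h j
    rw [colList, List.pairwise_filterMap, List.pairwise_iff_getElem] at hj
    simp only [List.mem_filterMap, Option.map_eq_some_iff, Prod.mk.injEq] at ha hb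
    obtain ⟨_, -, _, ha, rfl, rfl⟩ := ha
    obtain ⟨_, -, _, hb, rfl, rfl⟩ := hb
    exact hj p q hp hq hpq _ ha _ hb

/-- if `T` is obtained from a jellyfish tableau `U` by permuting entries
within columns (keeping the filled cells the same), then `sgn(U) = sgn(T)`, where for
column-permuted tableaux inversions within a column are not counted. -/
theorem statement1 (n d r : ℕ) (hn : 0 < n) (hd : 0 < d) (hr : 0 < r)
    (π : Fin d → Finset (Fin n)) (hπ : IsOSP n d r π)
    (U T : Tab (n - (d-1)*r) n d) (hU : IsJelly n d r π U)
    (hsome : ∀ i j, (T i j).isSome = (U i j).isSome)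
    (hperm : ∀ j, (colList T j).Perm (colList U j)) :
    tabSign U = tabSign' T := by
  have hmem : ∀ a ∈ cells U, a.2 ∈ π a.1 := fun a ha => by
    have := mem_colList.2 (mem_cells.1 ha)
    rwa [hU.2.2, Finset.mem_sort] at this
  have hdist : ∀ a ∈ cells U, ∀ b ∈ cells U, a.1 ≠ b.1 → a.2 ≠ b.2 :=
    fun a ha b hb hab he =>
      Finset.disjoint_left.1 (hπ.2.1 _ _ hab) (hmem a ha) (he ▸ hmem b hb)
  have hpar := natCast_invList'_congr hdist (cells_perm hperm).symm
    (map_fst_cells_congr hsome).symm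
  rw [tabSign, tabSign', invList_eq_invList' (pairwise_cells fun j => by
    rw [hU.2.2]
    exact Finset.pairwise_sort _ _)]
  rw [ZMod.natCast_eq_natCast_iff'] at hpar
  rw [neg_one_pow_eq_pow_mod_two, hpar, ← neg_one_pow_eq_pow_mod_two]

end Jellyfish
end

section
/- Let r ≥ 1 and partition {1,…,n} into three nonempty sets A, B, C with |C| = r. Then, as polynomials, [(A∪B | C)]_r = Σ_{S ⊆ C} (−1)^{|S|} [(A∪S | B∪(C∖S))]_r, where the sum is over all subsets S of C (including S = ∅ and S = C). -/
open scoped Classical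

namespace Jellyfish

lemma neg_one_pow_countP {α : Type*} (p : α → Bool) (l : List α) :
    (-1 : ℤ) ^ l.countP p = (l.map fun b => if p b then (-1 : ℤ) else 1).prod := by
  induction l with
  | nil => simp
  | cons a l ih =>
    by_cases h : p a <;> simp [h, ← ih, pow_succ]

lemma neg_one_pow_invList_ofFn {m n d : ℕ} (g : Fin m → Fin d × Fin n) :
    (-1 : ℤ) ^ invList (List.ofFn g) =
      ∏ i, ∏ j ∈ Finset.Ioi i, if (g j).2 < (g i).2 then (-1 : ℤ) else 1 := by
  induction m with
  | zero => simp [invList]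
  | succ m ih =>
    rw [List.ofFn_succ, invList, pow_add, neg_one_pow_countP, ih, Fin.prod_univ_succ,
      List.map_ofFn, List.prod_ofFn]
    simp [Fin.Ioi_zero_eq_map, Fin.Ioi_succ, -Fin.map_succEmb_Ioi]
    rfl

/-- For a word which is a permutation of `Fin n`, the parity of the number of inversions
is the sign of the permutation. -/
lemma neg_one_pow_invList_eq_sign {n d : ℕ} (l : List (Fin d × Fin n))
    (τ : Equiv.Perm (Fin n)) (h : l.map Prod.snd = List.ofFn τ) :
    (-1 : ℤ) ^ invList l = Equiv.Perm.sign τ := by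
  have hlen : l.length = n := by simpa using congrArg List.length h
  obtain ⟨g, rfl⟩ : ∃ g : Fin n → Fin d × Fin n, l = List.ofFn g :=
    ⟨fun i => l[(i : ℕ)], List.ext_getElem (by simp [hlen]) fun _ _ _ => by simp⟩
  rw [List.map_ofFn, List.ofFn_inj] at h
  rw [neg_one_pow_invList_ofFn, Equiv.Perm.sign_eq_prod_prod_Ioi, Units.coe_prod]
  refine Finset.prod_congr rfl fun i _ => ?_
  rw [Units.coe_prod]
  refine Finset.prod_congr rfl fun j hj => ?_
  have hne : τ i ≠ τ j := τ.injective.ne (Finset.mem_Ioi.1 hj).ne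
  have hi : (g i).2 = τ i := congrFun h i
  have hj' : (g j).2 = τ j := congrFun h j
  rw [hi, hj']
  rcases lt_or_gt_of_ne hne with h1 | h1 <;> simp [h1, not_lt.2 h1.le]

lemma det_submatrix_eq_sum {m K R : Type*} [Fintype m] [DecidableEq m] [Fintype K] [CommRing R]
    (e : m ≃ K) (M : Matrix K m R) :
    (M.submatrix e id).det =
      ∑ σ : Equiv.Perm m, (Equiv.Perm.sign σ : ℤ) • ∏ k, M k (σ (e.symm k)) := by
  rw [← Matrix.det_transpose, Matrix.det_apply]
  refine Finset.sum_congr rfl fun σ _ => ?_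
  rw [Units.smul_def]
  congr 1
  exact Fintype.prod_equiv e _ _ fun i => by simp

lemma filterMap_finRange_eq {ν : ℕ} {α : Type*} (g : Fin ν → Option α) :
    ((List.finRange ν).filterMap g).map some =
      (List.finRange (Finset.univ.filter fun i => (g i).isSome).card).map
        (fun a => g ((Finset.univ.filter fun i => (g i).isSome).orderEmbOfFin rfl a)) := by
  have h : (Finset.univ.filter fun i => (g i).isSome).sort (· ≤ ·) =
      (List.finRange ν).filter (fun i => (g i).isSome) := by
    apply List.Perm.eq_of_pairwise' (r := (· ≤ ·))
    · exact Finset.pairwise_sort _ _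
    · exact ((List.pairwise_le_finRange ν).filter _)
    · rw [List.perm_ext_iff_of_nodup (Finset.sort_nodup _ _) ((List.nodup_finRange ν).filter _)]
      simp
  rw [show (fun a => g ((Finset.univ.filter fun i => (g i).isSome).orderEmbOfFin rfl a)) =
    g ∘ ((Finset.univ.filter fun i => (g i).isSome).orderEmbOfFin rfl) from rfl, ← List.map_map,
    Finset.listMap_orderEmbOfFin_finRange, h]
  induction List.finRange ν with
  | nil => simp
  | cons a l ih =>
    cases hg : g a <;> simp [hg, ih]

lemma colList_eq_sort_iff {ν n d : ℕ} (T : Tab ν n d) (j : Fin d) (J : Finset (Fin n)) :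
    colList T j = J.sort (· ≤ ·) ↔ ∃ h : (rowsUsed T j).card = J.card,
      ∀ a, T ((rowsUsed T j).orderEmbOfFin h a) j = some (J.orderEmbOfFin rfl a) := by
  have key := filterMap_finRange_eq (fun i => T i j)
  rw [← (List.map_injective_iff.2 (Option.some_injective _)).eq_iff, colList, key]
  change (List.finRange (rowsUsed T j).card).map
    (fun a => T ((rowsUsed T j).orderEmbOfFin rfl a) j) = _ ↔ _
  generalize rowsUsed T j = R
  constructor
  · intro h
    have hc : R.card = J.card := by simpa using congrArg List.length h
    refine ⟨hc, fun a => ?_⟩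
    rw [← Finset.listMap_orderEmbOfFin_finRange J rfl, List.map_map] at h
    have := congrArg (fun l : List (Option (Fin n)) => l[(a : ℕ)]?) h
    have ha := a.2
    have ha' : (a : ℕ) < R.card := hc.symm ▸ ha
    simpa [ha, ha', Finset.orderEmbOfFin_apply] using this
  · rintro ⟨h, H⟩
    rw [← Finset.listMap_orderEmbOfFin_finRange J rfl, List.map_map]
    have : (some ∘ J.orderEmbOfFin rfl) =
      fun a => T (R.orderEmbOfFin h a) j := funext fun a => (H a).symm
    rw [this]
    clear H this
    generalize J.card = m at h
    subst h
    rfl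

lemma minor_eq_det {ν n m : ℕ} (I : Finset (Fin ν)) (J : Finset (Fin n)) (hI : I.card = m)
    (hJ : J.card = m) :
    minor ν n I J = Matrix.det (Matrix.of fun a b : Fin m =>
      (MvPolynomial.X (I.orderEmbOfFin hI a, J.orderEmbOfFin hJ b) :
        MvPolynomial (Fin ν × Fin n) ℂ)) := by
  subst hI
  rw [minor, dif_pos hJ.symm]

lemma det_blockDiagonal'_sigma {ι R : Type*} [Fintype ι] [LinearOrder ι] [CommRing R]
    {m : ι → Type*} [∀ i, Fintype (m i)] [∀ i, DecidableEq (m i)]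
    (M : ∀ i, Matrix (m i) (m i) R) :
    (Matrix.blockDiagonal' M).det = ∏ i, (M i).det := by
  rw [(Matrix.blockTriangular_blockDiagonal' M).det_fintype]
  refine Finset.prod_congr rfl fun i _ => ?_
  rw [← Matrix.det_submatrix_equiv_self (Equiv.sigmaSubtype i).symm]
  congr 1
  ext a b
  simp [Matrix.toSquareBlock_def, Equiv.sigmaSubtype]

/-- The column colouring of the cells `Fin r ⊕ Fin ν` of a two-column jellyfish shape: `inl i` is
the left cell of one of the first `r` rows, and `inr i` is the remaining cell of row `i`, whose
column is prescribed by the pattern `f`. -/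
def cellCol {r ν : ℕ} (f : Fin ν → Fin 2) : Fin r ⊕ Fin ν → Fin 2 :=
  Sum.elim (fun _ => 0) f

/-- The row of a cell of a two-column jellyfish shape. -/
def cellRow {r ν : ℕ} (hrν : r ≤ ν) : Fin r ⊕ Fin ν → Fin ν :=
  Sum.elim (Fin.castLE hrν) id

/-- The cells of a two-column jellyfish shape, in reading order. -/
def cellList (r ν : ℕ) : List (Fin r ⊕ Fin ν) :=
  (List.finRange ν).flatMap fun i : Fin ν =>
    if h : (i : ℕ) < r then [Sum.inl ⟨i, h⟩, Sum.inr i] else [Sum.inr i]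

lemma exists_cellList_eq_ofFn {r ν n : ℕ} (hrν : r ≤ ν) (hn : r + ν = n) :
    ∃ e : Fin n ≃ Fin r ⊕ Fin ν, cellList r ν = List.ofFn e := by
  have hmem : ∀ k, k ∈ cellList r ν := by
    rintro (i | i)
    · simp only [cellList, List.mem_flatMap]
      exact ⟨Fin.castLE hrν i, by simp, by simp⟩
    · simp only [cellList, List.mem_flatMap]
      exact ⟨i, by simp, by split_ifs <;> simp⟩
  have hnd : (cellList r ν).Nodup := by
    rw [cellList, List.nodup_flatMap]
    refine ⟨fun i _ => by split_ifs <;> simp, (List.nodup_finRange ν).imp ?_⟩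
    intro i j hij
    rw [Function.onFun, List.disjoint_left]
    rintro (k | k) <;> split_ifs <;> simp <;> grind
  let e := hnd.getEquivOfForallMemList _ hmem
  have hlen : (cellList r ν).length = n := by
    have := Fintype.card_congr e
    simp at this
    omega
  refine ⟨(finCongr hlen.symm).trans e, List.ext_getElem (by simp [hlen]) fun _ _ _ => ?_⟩
  simp [e]

section TwoColumns

variable {ν n r : ℕ}

/-- The conditions that `T` is a jellyfish tableau with two columns. -/
structure IsTwoJelly (r : ℕ) (π : Fin 2 → Finset (Fin n)) (T : Tab ν n 2) : Prop where
  top : ∀ i : Fin ν, (i : ℕ) < r → ∀ j, (T i j).isSome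
  bot : ∀ i : Fin ν, r ≤ (i : ℕ) → ∃! j, (T i j).isSome
  col : ∀ j, colList T j = (π j).sort (· ≤ ·)

/-- The column of the last entry of each row of a two-column tableau. -/
def pattern (T : Tab ν n 2) (i : Fin ν) : Fin 2 := if (T i 1).isSome then 1 else 0

lemma IsTwoJelly.isSome_iff {π : Fin 2 → Finset (Fin n)} {T : Tab ν n 2} (hT : IsTwoJelly r π T)
    (i : Fin ν) (j : Fin 2) : (T i j).isSome ↔ pattern T i = j ∨ ((i : ℕ) < r ∧ j = 0) := by
  by_cases hi : (i : ℕ) < r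
  · have h1 := hT.top i hi 1
    have := hT.top i hi j
    rw [pattern, if_pos h1]
    simp only [this, hi]
    fin_cases j <;> simp
  · obtain ⟨k, hk, hu⟩ := hT.bot i (not_lt.1 hi)
    rw [pattern]
    simp only [hi, false_and, or_false]
    constructor
    · intro h
      have := hu _ h
      subst this
      split_ifs with h1
      · exact hu _ h1
      · fin_cases j
        · rfl
        · exact absurd h h1
    · split_ifs with h1
      · rintro rfl; exact h1
      · rintro rfl
        fin_cases k
        · exact hk
        · exact absurd hk h1

lemma IsTwoJelly.pattern_of_lt {π : Fin 2 → Finset (Fin n)} {T : Tab ν n 2}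
    (hT : IsTwoJelly r π T) {i : Fin ν} (hi : (i : ℕ) < r) : pattern T i = 1 :=
  if_pos (hT.top i hi 1)

lemma IsTwoJelly.eq_of_pattern_eq {π : Fin 2 → Finset (Fin n)} {T T' : Tab ν n 2}
    (hT : IsTwoJelly r π T) (hT' : IsTwoJelly r π T') (h : pattern T = pattern T') : T = T' := by
  funext i j
  have hS : ∀ i j, (T i j).isSome ↔ (T' i j).isSome := fun i j => by
    rw [hT.isSome_iff, hT'.isSome_iff, h]
  by_cases hij : (T i j).isSome
  · obtain ⟨hc, H⟩ := (colList_eq_sort_iff T j _).1 (hT.col j)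
    obtain ⟨hc', H'⟩ := (colList_eq_sort_iff T' j _).1 (hT'.col j)
    have hR : rowsUsed T' j = rowsUsed T j := by
      ext i; simp [rowsUsed, hS]
    have hi : i ∈ (rowsUsed T j : Set (Fin ν)) := by simpa [rowsUsed] using hij
    rw [← Finset.range_orderEmbOfFin _ hc] at hi
    obtain ⟨a, rfl⟩ := hi
    rw [H]
    have := H' a
    simp only [hR] at this
    exact this.symm
  · have h2 := mt (hS i j).2 hij
    simp only [Option.not_isSome_iff_eq_none] at hij h2
    rw [hij, h2]

/-- The matrix whose determinant is the contribution of a single jellyfish shape. -/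
noncomputable def patternMatrix (hrν : r ≤ ν) (π : Fin 2 → Finset (Fin n)) (f : Fin ν → Fin 2) :
    Matrix (Fin r ⊕ Fin ν) (Fin n) (MvPolynomial (Fin ν × Fin n) ℂ) :=
  Matrix.of fun k v => if v ∈ π (cellCol f k) then MvPolynomial.X (cellRow hrν k, v) else 0

lemma cell_ext (hrν : r ≤ ν) {f : Fin ν → Fin 2} (hf : ∀ i : Fin ν, (i : ℕ) < r → f i = 1)
    {k k' : Fin r ⊕ Fin ν} (hcol : cellCol f k = cellCol f k')
    (hrow : cellRow hrν k = cellRow hrν k') : k = k' := by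
  have h : ∀ i : Fin r, f (Fin.castLE hrν i) ≠ 0 := fun i => by simp [hf (Fin.castLE hrν i) i.2]
  rcases k with k | k <;> rcases k' with k' | k' <;>
    simp only [cellCol, cellRow, Sum.elim_inl, Sum.elim_inr, id] at hcol hrow
  · simpa using hrow
  · subst hrow; exact absurd hcol.symm (h _)
  · subst hrow; exact absurd hcol (h _)
  · rw [hrow]

lemma IsTwoJelly.value_mem {π : Fin 2 → Finset (Fin n)} {T : Tab ν n 2}
    (hT : IsTwoJelly r π T) {i : Fin ν} {j : Fin 2} {v : Fin n} (h : T i j = some v) :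
    ∃ hc : (rowsUsed T j).card = (π j).card, ∃ a, (rowsUsed T j).orderEmbOfFin hc a = i ∧
      (π j).orderEmbOfFin rfl a = v := by
  obtain ⟨hc, H⟩ := (colList_eq_sort_iff T j _).1 (hT.col j)
  have hi : i ∈ (rowsUsed T j : Set (Fin ν)) := by simp [rowsUsed, h]
  rw [← Finset.range_orderEmbOfFin _ hc] at hi
  obtain ⟨a, rfl⟩ := hi
  exact ⟨hc, a, rfl, Option.some_injective _ ((H a).symm.trans h)⟩

lemma IsTwoJelly.mem_of_eq_some {π : Fin 2 → Finset (Fin n)} {T : Tab ν n 2}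
    (hT : IsTwoJelly r π T) {i : Fin ν} {j : Fin 2} {v : Fin n} (h : T i j = some v) :
    v ∈ π j := by
  obtain ⟨hc, a, -, rfl⟩ := hT.value_mem h
  exact Finset.orderEmbOfFin_mem _ _ _

lemma IsTwoJelly.row_eq {π : Fin 2 → Finset (Fin n)} {T : Tab ν n 2}
    (hT : IsTwoJelly r π T) {i i' : Fin ν} {j : Fin 2} {v : Fin n} (h : T i j = some v)
    (h' : T i' j = some v) : i = i' := by
  obtain ⟨hc, a, rfl, ha⟩ := hT.value_mem h
  obtain ⟨hc', a', rfl, ha'⟩ := hT.value_mem h'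
  rw [((π j).orderEmbOfFin rfl).injective (ha.trans ha'.symm)]

lemma IsTwoJelly.exists_equiv {π : Fin 2 → Finset (Fin n)} {T : Tab ν n 2} {β : Fin n → Fin 2}
    (hrν : r ≤ ν) (hn : r + ν = n) (hβ : ∀ v c, v ∈ π c ↔ β v = c)
    (hT : IsTwoJelly r π T) : ∃ e : Fin r ⊕ Fin ν ≃ Fin n,
      ∀ k, T (cellRow hrν k) (cellCol (pattern T) k) = some (e k) := by
  have hsome : ∀ k, (T (cellRow hrν k) (cellCol (pattern T) k)).isSome := by
    rintro (k | k) <;> simp [hT.isSome_iff, cellRow, cellCol]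
  choose v hv using fun k => Option.isSome_iff_exists.1 (hsome k)
  have hinj : Function.Injective v := by
    intro k k' hkk
    have h1 := hT.mem_of_eq_some (hv k)
    have h2 := hT.mem_of_eq_some (hv k')
    have hcol : cellCol (pattern T) k = cellCol (pattern T) k' := by
      rw [← (hβ _ _).1 h1, ← (hβ _ _).1 h2, hkk]
    refine cell_ext hrν (fun i => hT.pattern_of_lt) hcol ?_
    have h3 := hv k'
    rw [← hkk, ← hcol] at h3
    exact hT.row_eq (hv k) h3
  have hbij : Function.Bijective v :=
    (Fintype.bijective_iff_injective_and_card v).2 ⟨hinj, by simpa using hn⟩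
  exact ⟨Equiv.ofBijective v hbij, hv⟩

lemma IsTwoJelly.map_snd_cells {π : Fin 2 → Finset (Fin n)} {T : Tab ν n 2}
    (hrν : r ≤ ν) (hT : IsTwoJelly r π T) (e : Fin r ⊕ Fin ν → Fin n)
    (he : ∀ k, T (cellRow hrν k) (cellCol (pattern T) k) = some (e k)) :
    (cells T).map Prod.snd = (cellList r ν).map e := by
  rw [cells, cellList, List.map_flatMap, List.map_flatMap]
  congr 1
  funext i
  have h2 : List.finRange 2 = [0, 1] := rfl
  have hr := he (Sum.inr i)
  simp only [cellRow, cellCol, Sum.elim_inr, id] at hr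
  rw [h2]
  split_ifs with hi
  · have hl := he (Sum.inl ⟨i, hi⟩)
    have hil : Fin.castLE hrν ⟨i, hi⟩ = i := rfl
    simp only [cellRow, cellCol, Sum.elim_inl, hil] at hl
    rw [hT.pattern_of_lt hi] at hr
    simp [hl, hr]
  · have hS := fun j => hT.isSome_iff i j
    simp only [hi, false_and, or_false] at hS
    obtain h0 | h1 : pattern T i = 0 ∨ pattern T i = 1 := by
      generalize pattern T i = c; fin_cases c <;> simp
    · have hn1 : T i 1 = none := by simpa [h0] using hS 1
      rw [h0] at hr
      simp [hr, hn1]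
    · have hn0 : T i 0 = none := by simpa [h1] using hS 0
      rw [h1] at hr
      simp [hr, hn0]

lemma IsTwoJelly.tabSign_smul_JProd {π : Fin 2 → Finset (Fin n)} {T : Tab ν n 2}
    {β : Fin n → Fin 2} (hrν : r ≤ ν) (hn : r + ν = n) (hβ : ∀ v c, v ∈ π c ↔ β v = c)
    (e₀ : Fin n ≃ Fin r ⊕ Fin ν) (he₀ : cellList r ν = List.ofFn e₀) (hT : IsTwoJelly r π T) :
    (tabSign T : ℂ) • JProd π T =
      ((patternMatrix hrν π (pattern T)).submatrix e₀ id).det := by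
  obtain ⟨e, he⟩ := hT.exists_equiv hrν hn hβ
  have hsign : tabSign T = Equiv.Perm.sign (e₀.trans e) := by
    apply neg_one_pow_invList_eq_sign
    rw [hT.map_snd_cells hrν e he, he₀, List.map_ofFn]
    rfl
  let ψ' : (Σ c, Fin (π c).card) → Fin n := fun p => (π p.1).orderEmbOfFin rfl p.2
  have hψ'mem : ∀ p, ψ' p ∈ π p.1 := fun p => Finset.orderEmbOfFin_mem _ _ _
  have hψ' : Function.Bijective ψ' := by
    constructor
    · rintro ⟨c, a⟩ ⟨c', a'⟩ h
      have h1 := (hβ _ _).1 (hψ'mem ⟨c, a⟩)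
      have h2 := (hβ _ _).1 (hψ'mem ⟨c', a'⟩)
      rw [h, h2] at h1
      dsimp only at h1
      subst h1
      exact congrArg _ (((π c').orderEmbOfFin rfl).injective h)
    · intro v
      have hv : v ∈ (π (β v) : Set (Fin n)) := by simp [hβ]
      rw [← Finset.range_orderEmbOfFin _ rfl] at hv
      obtain ⟨a, ha⟩ := hv
      exact ⟨⟨β v, a⟩, ha⟩
  let ψ := Equiv.ofBijective ψ' hψ'
  have hcard : ∀ c, (rowsUsed T c).card = (π c).card := fun c =>
    ((colList_eq_sort_iff T c _).1 (hT.col c)).1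
  have hcol : ∀ p, cellCol (pattern T) (e.symm (ψ p)) = p.1 := fun p => by
    have h1 := hT.mem_of_eq_some (he (e.symm (ψ p)))
    rw [Equiv.apply_symm_apply, hβ] at h1
    rw [← h1]
    exact (hβ _ _).1 (hψ'mem p)
  have hrow : ∀ p : Σ c, Fin (π c).card,
      cellRow hrν (e.symm (ψ p)) = (rowsUsed T p.1).orderEmbOfFin (hcard p.1) p.2 := fun p => by
    have h1 := he (e.symm (ψ p))
    rw [Equiv.apply_symm_apply, hcol] at h1
    obtain ⟨hc, a, ha, ha'⟩ := hT.value_mem h1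
    rw [← ha, ((π p.1).orderEmbOfFin rfl).injective ha']
  have hblock : (patternMatrix hrν π (pattern T)).submatrix (e.symm ∘ ψ) ψ =
      Matrix.blockDiagonal' fun c => Matrix.of fun a b : Fin (π c).card =>
        (MvPolynomial.X ((rowsUsed T c).orderEmbOfFin (hcard c) a, (π c).orderEmbOfFin rfl b) :
          MvPolynomial (Fin ν × Fin n) ℂ) := by
    ext1 ⟨c, a⟩ ⟨c', b⟩
    rw [Matrix.submatrix_apply, Matrix.blockDiagonal'_apply, patternMatrix, Matrix.of_apply,
      Function.comp_apply, hcol, hrow]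
    have hmem : ψ ⟨c', b⟩ ∈ π c ↔ c = c' := by
      rw [hβ, show β (ψ ⟨c', b⟩) = c' from (hβ _ _).1 (hψ'mem ⟨c', b⟩), eq_comm]
    simp only [hmem]
    split_ifs with h
    · subst h; rfl
    · rfl
  have hdet := congrArg Matrix.det hblock
  rw [det_blockDiagonal'_sigma] at hdet
  have hJ : JProd π T = ((patternMatrix hrν π (pattern T)).submatrix (e.symm ∘ ψ) ψ).det := by
    rw [hdet, JProd]
    exact Finset.prod_congr rfl fun c _ => minor_eq_det _ _ (hcard c) rfl
  have hperm : (patternMatrix hrν π (pattern T)).submatrix e₀ id =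
      ((patternMatrix hrν π (pattern T)).submatrix e.symm id).submatrix (e₀.trans e) id := by
    ext1 i j; simp
  have hψdet : (((patternMatrix hrν π (pattern T)).submatrix e.symm id).submatrix ψ ψ).det =
    ((patternMatrix hrν π (pattern T)).submatrix e.symm id).det := Matrix.det_submatrix_equiv_self _ _
  rw [hperm, Matrix.det_permute, hJ, hsign, ← hψdet, Matrix.submatrix_submatrix, Algebra.smul_def]
  simp

lemma exists_isTwoJelly_of_equiv {π : Fin 2 → Finset (Fin n)} {β : Fin n → Fin 2} (hrν : r ≤ ν)
    (hβ : ∀ v c, v ∈ π c ↔ β v = c) {f : Fin ν → Fin 2} (hf : ∀ i : Fin ν, (i : ℕ) < r → f i = 1)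
    (τ : Fin r ⊕ Fin ν ≃ Fin n) (hτ : ∀ k, τ k ∈ π (cellCol f k)) :
    ∃ T : Tab ν n 2, IsTwoJelly r π T ∧ pattern T = f := by
  let R : Fin 2 → Finset (Fin ν) := fun c =>
    Finset.univ.filter fun i => f i = c ∨ ((i : ℕ) < r ∧ c = 0)
  have hR : ∀ i c, i ∈ R c ↔ f i = c ∨ ((i : ℕ) < r ∧ c = 0) := fun i c => by simp [R]
  have hcard : ∀ c, (R c).card = (π c).card := by
    intro c
    let F : Finset (Fin r ⊕ Fin ν) := Finset.univ.filter fun k => cellCol f k = c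
    have hF : ∀ k, k ∈ F ↔ cellCol f k = c := fun k => by simp [F]
    have h1 : R c = F.image (cellRow hrν) := by
      ext i
      rw [hR, Finset.mem_image]
      constructor
      · rintro (h | ⟨h, rfl⟩)
        · exact ⟨Sum.inr i, (hF _).2 h, rfl⟩
        · exact ⟨Sum.inl ⟨i, h⟩, (hF _).2 rfl, rfl⟩
      · rintro ⟨k | k, hk, rfl⟩
        · exact Or.inr ⟨k.2, ((hF _).1 hk).symm⟩
        · exact Or.inl ((hF _).1 hk)
    have h2 : π c = F.image τ := by
      ext v
      obtain ⟨k, rfl⟩ := τ.surjective v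
      rw [hβ, (hβ _ _).1 (hτ k)]
      simp [F]
    rw [h1, h2, Finset.card_image_of_injective _ τ.injective, Finset.card_image_of_injOn]
    intro k hk k' hk' h
    have hk : cellCol f k = c := (hF _).1 hk
    have hk' : cellCol f k' = c := (hF _).1 hk'
    exact cell_ext hrν hf (hk.trans hk'.symm) h
  let T : Tab ν n 2 := fun i c =>
    if h : i ∈ R c then
      some ((π c).orderEmbOfFin rfl (((R c).orderIsoOfFin (hcard c)).symm ⟨i, h⟩))
    else none
  have hS : ∀ i c, (T i c).isSome ↔ i ∈ R c := fun i c => by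
    by_cases h : i ∈ R c <;> simp [T, h]
  have hrows : ∀ c, rowsUsed T c = R c := fun c => by
    ext i; simp [rowsUsed, hS]
  refine ⟨T, ⟨?_, ?_, ?_⟩, ?_⟩
  · intro i hi j
    rw [hS, hR, hf i hi]
    fin_cases j <;> simp [hi]
  · intro i hi
    simp [hS, hR, not_lt.2 hi]
  · intro c
    rw [colList_eq_sort_iff, hrows]
    refine ⟨hcard c, fun a => ?_⟩
    simp only [T]
    rw [dif_pos (Finset.orderEmbOfFin_mem _ _ _)]
    congr 2
    rw [OrderIso.symm_apply_eq]
    rfl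
  · funext i
    have := hS i 1
    rw [hR] at this
    rw [pattern]
    simp only [this]
    generalize f i = c
    fin_cases c <;> simp

/-- The matrix of all rows `x_i` preceded by the first `r` rows restricted to the columns in `P`. -/
noncomputable def stackedMatrix (hrν : r ≤ ν) (P : Finset (Fin n)) :
    Matrix (Fin r ⊕ Fin ν) (Fin n) (MvPolynomial (Fin ν × Fin n) ℂ) :=
  Matrix.of fun k v =>
    if k.isLeft → v ∈ P then MvPolynomial.X (cellRow hrν k, v) else 0

lemma sum_det_patternMatrix {π : Fin 2 → Finset (Fin n)} {β : Fin n → Fin 2} (hrν : r ≤ ν)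
    (hβ : ∀ v c, v ∈ π c ↔ β v = c) (e₀ : Fin n ≃ Fin r ⊕ Fin ν) :
    ∑ f : Fin ν → Fin 2, ((patternMatrix hrν π f).submatrix e₀ id).det =
      ((stackedMatrix hrν (π 0)).submatrix e₀ id).det := by
  simp_rw [det_submatrix_eq_sum]
  rw [Finset.sum_comm]
  refine Finset.sum_congr rfl fun σ _ => ?_
  rw [← Finset.smul_sum]
  congr 1
  simp only [Fintype.prod_sum_type]
  let x : Fin r ⊕ Fin ν → MvPolynomial (Fin ν × Fin n) ℂ := fun k =>
    MvPolynomial.X (cellRow hrν k, σ (e₀.symm k))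
  change ∑ f : Fin ν → Fin 2,
      (∏ i, if σ (e₀.symm (Sum.inl i)) ∈ π 0 then x (Sum.inl i) else 0) *
        ∏ i, (if σ (e₀.symm (Sum.inr i)) ∈ π (f i) then x (Sum.inr i) else 0) = _
  rw [← Finset.mul_sum]
  congr 1
  · simp [stackedMatrix, x]
  rw [← Fintype.prod_sum fun (i : Fin ν) (c : Fin 2) =>
    if σ (e₀.symm (Sum.inr i)) ∈ π c then x (Sum.inr i) else 0]
  exact Finset.prod_congr rfl fun i _ => by simp [hβ, stackedMatrix, x]

lemma det_patternMatrix_eq_zero {π : Fin 2 → Finset (Fin n)} {β : Fin n → Fin 2} (hrν : r ≤ ν)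
    (hβ : ∀ v c, v ∈ π c ↔ β v = c) (e₀ : Fin n ≃ Fin r ⊕ Fin ν) (f : Fin ν → Fin 2)
    (hf : ∀ T : Tab ν n 2, IsTwoJelly r π T → pattern T ≠ f) :
    ((patternMatrix hrν π f).submatrix e₀ id).det = 0 := by
  by_cases hf1 : ∀ i : Fin ν, (i : ℕ) < r → f i = 1
  · rw [det_submatrix_eq_sum]
    refine Finset.sum_eq_zero fun σ _ => ?_
    suffices h : ∃ k, σ (e₀.symm k) ∉ π (cellCol f k) by
      obtain ⟨k, hk⟩ := h
      rw [Finset.prod_eq_zero (Finset.mem_univ k) (by simp [patternMatrix, hk]), smul_zero]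
    by_contra! h
    obtain ⟨T, hT, hTf⟩ := exists_isTwoJelly_of_equiv hrν hβ hf1 (e₀.symm.trans σ) h
    exact hf T hT hTf
  · push Not at hf1
    obtain ⟨i, hi, hfi⟩ := hf1
    have hfi : f i = 0 := by
      generalize f i = c at hfi ⊢
      fin_cases c <;> simp_all
    refine Matrix.det_zero_of_row_eq
      (i := e₀.symm (Sum.inl ⟨i, hi⟩)) (j := e₀.symm (Sum.inr i)) (by simp) ?_
    ext1 v
    simp [patternMatrix, cellCol, cellRow, hfi]
    rfl

lemma sum_isTwoJelly_eq_det {π : Fin 2 → Finset (Fin n)} {β : Fin n → Fin 2} (hrν : r ≤ ν)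
    (hn : r + ν = n) (hβ : ∀ v c, v ∈ π c ↔ β v = c)
    (e₀ : Fin n ≃ Fin r ⊕ Fin ν) (he₀ : cellList r ν = List.ofFn e₀) :
    ∑ T : Tab ν n 2, (if IsTwoJelly r π T then (tabSign T : ℂ) • JProd π T else 0) =
      ((stackedMatrix hrν (π 0)).submatrix e₀ id).det := by
  rw [← sum_det_patternMatrix hrν hβ, ← Finset.sum_filter]
  refine Finset.sum_of_injOn pattern ?_ (fun _ _ => Finset.mem_coe.2 (Finset.mem_univ _)) ?_ ?_
  · intro T hT T' hT' h
    simp only [Finset.coe_filter, Finset.mem_univ, true_and, Set.mem_ofPred_eq] at hT hT'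
    exact hT.eq_of_pattern_eq hT' h
  · intro f _ hf
    refine det_patternMatrix_eq_zero hrν hβ e₀ f fun T hT hTf => hf ⟨T, ?_, hTf⟩
    simpa using hT
  · intro T hT
    exact (Finset.mem_filter.1 hT).2.tabSign_smul_JProd hrν hn hβ e₀ he₀

lemma det_stackedMatrix_compl (hrν : r ≤ ν) (e₀ : Fin n ≃ Fin r ⊕ Fin ν) (P : Finset (Fin n)) :
    ((stackedMatrix hrν Pᶜ).submatrix e₀ id).det =
      (-1) ^ r * ((stackedMatrix hrν P).submatrix e₀ id).det := by
  let U : Matrix (Fin r ⊕ Fin ν) (Fin r ⊕ Fin ν) (MvPolynomial (Fin ν × Fin n) ℂ) :=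
    Matrix.fromBlocks (-1) (Matrix.of fun i j => if Fin.castLE hrν i = j then 1 else 0) 0 1
  have hU : U.det = (-1) ^ r := by
    simp [U, Matrix.det_neg]
  have hmul : stackedMatrix hrν Pᶜ = U * stackedMatrix hrν P := by
    ext1 k v
    rw [Matrix.mul_apply, Fintype.sum_sum_type]
    rcases k with i | i
    · by_cases hv : v ∈ P <;>
        simp [U, stackedMatrix, hv, cellRow, Matrix.one_apply, Matrix.neg_apply]
    · simp [U, stackedMatrix, cellRow, Matrix.one_apply]
  have hsub : (stackedMatrix hrν Pᶜ).submatrix e₀ id =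
      U.submatrix e₀ e₀ * (stackedMatrix hrν P).submatrix e₀ id := by
    rw [hmul, Matrix.submatrix_mul_equiv]
  rw [hsub, Matrix.det_mul, Matrix.det_submatrix_equiv_self, hU]

lemma det_stackedMatrix (hrν : r ≤ ν) (e₀ : Fin n ≃ Fin r ⊕ Fin ν) (P : Finset (Fin n)) :
    ((stackedMatrix hrν P).submatrix e₀ id).det =
      ∑ σ : Equiv.Perm (Fin n),
        (if Finset.univ.image (fun i => σ (e₀.symm (Sum.inl i))) ⊆ P then (1 : ℂ) else 0) •
          ((Equiv.Perm.sign σ : ℤ) •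
            ∏ k, (MvPolynomial.X (cellRow hrν k, σ (e₀.symm k)) :
              MvPolynomial (Fin ν × Fin n) ℂ)) := by
  rw [det_submatrix_eq_sum]
  refine Finset.sum_congr rfl fun σ _ => ?_
  rw [ite_smul, one_smul, zero_smul]
  simp only [stackedMatrix, Matrix.of_apply, Finset.prod_ite_zero, Finset.mem_univ, true_imp_iff,
    Finset.image_subset_iff, Sum.forall, Sum.isLeft_inl, Sum.isLeft_inr, Bool.false_eq_true,
    false_imp_iff, implies_true, and_true]
  split_ifs <;> simp

lemma sum_powerset_neg_one_pow_card_smul_ite {α : Type*} [DecidableEq α] {A C U : Finset α}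
    (hAC : Disjoint A C) (hU : U.card = C.card) :
    ∑ S ∈ C.powerset, (-1 : ℂ) ^ S.card * (if U ⊆ A ∪ S then 1 else 0) =
      (-1) ^ C.card * (if U ⊆ C then 1 else 0) := by
  by_cases hUC : U ⊆ C
  · obtain rfl : U = C := Finset.eq_of_subset_of_card_le hUC hU.ge
    rw [Finset.sum_eq_single_of_mem U (Finset.mem_powerset_self _)]
    · simp
    · intro S hS hne
      rw [if_neg, mul_zero]
      intro h
      exact hne (Finset.Subset.antisymm (Finset.mem_powerset.1 hS)
        (hAC.symm.left_le_of_le_sup_left h))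
  · obtain ⟨c, hc, hcU⟩ : ∃ c ∈ C, c ∉ U := by
      by_contra! h
      exact hUC (Finset.eq_of_subset_of_card_le h hU.le).ge
    rw [if_neg hUC, mul_zero, ← Finset.insert_erase hc,
      Finset.sum_powerset_insert (Finset.notMem_erase c C), ← Finset.sum_add_distrib]
    refine Finset.sum_eq_zero fun S hS => ?_
    have hcS : c ∉ S := fun h => Finset.notMem_erase c C (Finset.mem_powerset.1 hS h)
    simp only [Finset.card_insert_of_notMem hcS, Finset.union_insert,
      Finset.subset_insert_iff_of_notMem hcU, pow_succ]
    ring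

lemma sum_powerset_det_stackedMatrix (hrν : r ≤ ν) (e₀ : Fin n ≃ Fin r ⊕ Fin ν)
    {A C : Finset (Fin n)} (hAC : Disjoint A C) (hC : C.card = r) :
    ∑ S ∈ C.powerset, (-1 : ℂ) ^ S.card • ((stackedMatrix hrν (A ∪ S)).submatrix e₀ id).det =
      (-1) ^ r * ((stackedMatrix hrν C).submatrix e₀ id).det := by
  simp_rw [det_stackedMatrix, Finset.smul_sum, smul_smul]
  rw [Finset.sum_comm, Finset.mul_sum]
  refine Finset.sum_congr rfl fun σ _ => ?_
  rw [← Finset.sum_smul, sum_powerset_neg_one_pow_card_smul_ite hAC, hC, mul_smul,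
    Algebra.smul_def ((-1 : ℂ) ^ r)]
  · simp
  · rw [Finset.card_image_of_injective, hC, Finset.card_univ, Fintype.card_fin]
    exact σ.injective.comp (e₀.symm.injective.comp Sum.inl_injective)

lemma isJelly_two_iff {π : Fin 2 → Finset (Fin n)} {T : Tab (n - (2 - 1) * r) n 2} :
    IsJelly n 2 r π T ↔ IsTwoJelly r π T :=
  ⟨fun h => ⟨h.1, h.2.1, h.2.2⟩, fun h => ⟨h.top, h.bot, h.col⟩⟩

lemma jellyInv_eq_det (hrn : r ≤ n) (hrν : r ≤ n - (2 - 1) * r)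
    (e₀ : Fin n ≃ Fin r ⊕ Fin (n - (2 - 1) * r))
    (he₀ : cellList r (n - (2 - 1) * r) = List.ofFn e₀) {P Q : Finset (Fin n)}
    (hPQ : Disjoint P Q) (hun : P ∪ Q = Finset.univ) :
    jellyInv n 2 r ![P, Q] = ((stackedMatrix hrν P).submatrix e₀ id).det := by
  have hβ : ∀ v c, v ∈ ![P, Q] c ↔ (if v ∈ P then (0 : Fin 2) else 1) = c := by
    intro v c
    have hv : v ∈ P ∨ v ∈ Q := Finset.mem_union.1 (hun ▸ Finset.mem_univ v)
    have hv' : v ∈ P → v ∉ Q := fun h => Finset.disjoint_left.1 hPQ h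
    fin_cases c <;> by_cases h : v ∈ P <;> simp [h, hv']
    tauto
  rw [jellyInv]
  simp_rw [isJelly_two_iff]
  exact sum_isTwoJelly_eq_det hrν (by omega) hβ e₀ he₀

lemma jellyInv_eq_zero (hrn : r ≤ n) (hrν : n - (2 - 1) * r < r) {P Q : Finset (Fin n)}
    (hPQ : Disjoint P Q) (hun : P ∪ Q = Finset.univ) : jellyInv n 2 r ![P, Q] = 0 := by
  refine Finset.sum_eq_zero fun T _ => if_neg fun hT => ?_
  have hcard : ∀ j, n - (2 - 1) * r = (![P, Q] j).card := fun j => by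
    obtain ⟨hc, -⟩ := (colList_eq_sort_iff T j _).1 (hT.2.2 j)
    rw [← hc, show rowsUsed T j = Finset.univ from
      Finset.filter_true_of_mem fun i _ => hT.1 i (i.2.trans hrν) j, Finset.card_univ,
      Fintype.card_fin]
  have h0 := hcard 0
  have h1 := hcard 1
  have hsum := Finset.card_union_of_disjoint hPQ
  rw [hun, Finset.card_univ, Fintype.card_fin] at hsum
  simp only [Matrix.cons_val_zero, Matrix.cons_val_one] at h0 h1
  omega

end TwoColumns

/-- the `(2^r + 1)`-term recurrence
`[(A∪B | C)]_r = Σ_{S ⊆ C} (−1)^{|S|} [(A∪S | B∪(C∖S))]_r`. -/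
theorem statement3 (n r : ℕ) (hr : 1 ≤ r) (A B C : Finset (Fin n))
    (hA : A.Nonempty) (hB : B.Nonempty) (hC : C.Nonempty)
    (hAB : Disjoint A B) (hAC : Disjoint A C) (hBC : Disjoint B C)
    (hunion : A ∪ B ∪ C = Finset.univ) (hCcard : C.card = r) :
    jellyInv n 2 r ![A ∪ B, C] =
      ∑ S ∈ C.powerset,
        ((-1 : ℂ)) ^ S.card • jellyInv n 2 r ![A ∪ S, B ∪ (C \ S)] := by
  have hrn : r ≤ n := by simpa [hCcard] using C.card_le_univ
  have hdisj : Disjoint (A ∪ B) C := Finset.disjoint_union_left.2 ⟨hAC, hBC⟩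
  have hdisjS : ∀ S ∈ C.powerset, Disjoint (A ∪ S) (B ∪ (C \ S)) := by
    intro S hS
    have hSC := Finset.mem_powerset.1 hS
    exact Finset.disjoint_union_left.2
      ⟨Finset.disjoint_union_right.2 ⟨hAB, hAC.mono_right Finset.sdiff_subset⟩,
        Finset.disjoint_union_right.2 ⟨(hBC.mono_right hSC).symm, Finset.disjoint_sdiff⟩⟩
  have hunS : ∀ S ∈ C.powerset, (A ∪ S) ∪ (B ∪ (C \ S)) = Finset.univ := by
    intro S hS
    rw [Finset.union_union_union_comm, Finset.union_sdiff_of_subset (Finset.mem_powerset.1 hS),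
      hunion]
  rcases le_or_gt r (n - (2 - 1) * r) with hrν | hrν
  · obtain ⟨e₀, he₀⟩ := exists_cellList_eq_ofFn (n := n) hrν (by omega)
    rw [jellyInv_eq_det hrn hrν e₀ he₀ hdisj hunion,
      Finset.sum_congr rfl fun S hS => congrArg (((-1 : ℂ) ^ S.card) • ·)
        (jellyInv_eq_det hrn hrν e₀ he₀ (hdisjS S hS) (hunS S hS)),
      sum_powerset_det_stackedMatrix hrν e₀ hAC hCcard, ← det_stackedMatrix_compl]
    rw [← (isCompl_iff.2 ⟨hdisj, codisjoint_iff.2 hunion⟩).eq_compl]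
  · rw [jellyInv_eq_zero hrn hrν hdisj hunion]
    exact (Finset.sum_eq_zero fun S hS => by
      rw [jellyInv_eq_zero hrn hrν (hdisjS S hS) (hunS S hS), smul_zero]).symm

end Jellyfish
end
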